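/- Let R be a (not necessarily commutative) ring and let x, y ∈ R satisfy y * x = - (x * y). Then for every natural number m, (x + y)^(2*m+1) = ∑_{k=0}^{m} (m choose k) * (x^(2*k+1) * y^(2*(m-k)) + x^(2*k) * y^(2*(m-k)+1)). -/

import Mathlib

theorem commute_sq_of_mul_eq_neg_mul {R : Type*} [Ring R] {x y : R}
    (h : y * x = -(x * y)) : Commute (y ^ 2) x := by
  change y ^ 2 * x = x * y ^ 2
  rw [sq, mul_assoc, h, mul_neg, ← mul_assoc, h, neg_mul, neg_neg, mul_assoc]

theorem add_sq_of_mul_eq_neg_mul {R : Type*} [Ring R] {x y : R}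
    (h : y * x = -(x * y)) : (x + y) ^ 2 = x ^ 2 + y ^ 2 := by
  rw [sq, add_mul, mul_add, mul_add, h]
  noncomm_ring

theorem pauli_pascal_odd_row (R : Type*) [Ring R] (x y : R)
    (h : y * x = -(x * y)) (m : ℕ) :
    (x + y) ^ (2 * m + 1) =
      ∑ k ∈ Finset.range (m + 1),
        (m.choose k : R) *
          (x ^ (2 * k + 1) * y ^ (2 * (m - k)) + x ^ (2 * k) * y ^ (2 * (m - k) + 1)) := by
  have hc : Commute (y ^ 2) x := commute_sq_of_mul_eq_neg_mul h
  rw [pow_succ, pow_mul, add_sq_of_mul_eq_neg_mul h, (hc.symm.pow_left 2).add_pow,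
    Finset.sum_mul]
  refine Finset.sum_congr rfl fun k _ => ?_
  rw [← (Nat.cast_commute (m.choose k) _).eq, mul_assoc, ← pow_mul, mul_assoc, mul_add,
    (hc.pow_left (m - k)).eq, mul_add, ← mul_assoc, ← pow_succ, ← pow_mul, ← pow_succ]
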